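/- Let G be an M × m matrix over GF(3) whose rows g_1, …, g_M are linearly independent. For a user block b ∈ {0,1}^M define the finite-field sum-pattern w(b) = Σ_j u_j(b_j) ∈ GF(3)^m, where u_j(1) = g_j and u_j(0) = 2·g_j. Then the map b ↦ w(b) is injective on {0,1}^M, i.e., the AI-CWEP code with full-one generator matrix G is uniquely decodable. -/

import Mathlib

/-- **Unique decodability of AI-CWEP codes over GF(3^m) (Theorem 4).**
If the rows `g_1, …, g_M` of the full-one generator matrix `G` over GF(3)
are linearly independent, then the finite-field sum-pattern map
`b ↦ Σ_j u_j(b_j)`, where `u_j(1) = g_j` and `u_j(0) = 2 • g_j`, is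
injective on user blocks `b ∈ {0,1}^M`. -/
theorem aicwep_uniquely_decodable (M m : ℕ)
    (G : Matrix (Fin M) (Fin m) (ZMod 3))
    (hli : LinearIndependent (ZMod 3) (fun j : Fin M => G j)) :
    Function.Injective
      (fun b : Fin M → Bool =>
        ∑ j : Fin M, (if b j then (1 : ZMod 3) else 2) • G j) := by
  intro b c h
  funext j
  have hcoeff := hli.fintypeLinearCombination_injective
    (a₁ := fun j => if b j then (1 : ZMod 3) else 2)
    (a₂ := fun j => if c j then (1 : ZMod 3) else 2)
    (by simpa only [Fintype.linearCombination_apply] using h)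
  have hj := congrFun hcoeff j
  have hne : (1 : ZMod 3) ≠ 2 := by decide
  cases hb : b j <;> cases hc : c j <;> simp_all [hne.symm]
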